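/- arXiv:1604.03918 — 4 statements merged into one kernel-verified Lean document; each statement's English description precedes it below -/
import Mathlib

section
/- Fix c > 0 and an integer K ≥ 2. For each integer n > c define δ^n = (δ^n_0, …, δ^n_{K−1}) : [0,1]^K → ℝ^K by, with m(α) = ⌊nα_0⌋ + ⋯ + ⌊nα_{K−2}⌋ and p_n = c/n: δ^n_0(α) = −⌊nα_0⌋ p_n (1−p_n)^{⌊nα_{K−1}⌋} B(m(α)−1, p_n; K−2) + b(m(α), p_n; 0)(1−p_n)^{⌊nα_{K−1}⌋}; δ^n_k(α) = (⌊nα_{k−1}⌋ − ⌊nα_k⌋) p_n (1−p_n)^{⌊nα_{K−1}⌋} B(m(α)−1, p_n; K−2) + b(m(α), p_n; k)(1−p_n)^{⌊nα_{K−1}⌋} for 1 ≤ k ≤ K−2; δ^n_{K−1}(α) = ⌊nα_{K−2}⌋ p_n (1−p_n)^{⌊nα_{K−1}⌋} B(m(α)−1, p_n; K−2) + b(m(α), p_n; K−1)(1−p_n)^{⌊nα_{K−1}⌋}. Then δ^n converges uniformly on [0,1]^K (in the sup-norm) as n → ∞ to the function δ given by δ_0(α) = −c α_0 e^{−c α_{≤K−1}}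 S(α) + e^{−c α_{≤K−1}}; δ_k(α) = c(α_{k−1} − α_k) e^{−c α_{≤K−1}} S(α) + e^{−c α_{≤K−1}} c^k α_{≤K−2}^k / k! for 1 ≤ k ≤ K−2; δ_{K−1}(α) = c α_{K−2} e^{−c α_{≤K−1}} S(α) + e^{−c α_{≤K−1}} c^{K−1} α_{≤K−2}^{K−1} / (K−1)!. -/
open Finset Filter

/-- The probability that a binomial random variable with `n` trials and success
probability `p` takes the value `k`, i.e. `b(n, p; k)`. -/
noncomputable def binomialProb (n : ℕ) (p : ℝ) (k : ℕ) : ℝ :=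
  (n.choose k : ℝ) * p ^ k * (1 - p) ^ (n - k)

/-- `B(N, p; k) = P(Bin(N, p) ≤ k)` for `N ≥ 0`, with the convention `B(N, p; k) = 1`
for negative `N`. -/
noncomputable def binomialCDFz (N : ℤ) (p : ℝ) (k : ℕ) : ℝ :=
  if N < 0 then 1 else ∑ j ∈ Finset.range (k + 1), binomialProb N.toNat p j

/-- `α_{≤k} = α 0 + ⋯ + α k` for `α ∈ ℝ^K`. -/
noncomputable def partialSum {K : ℕ} (α : Fin K → ℝ) (k : ℕ) : ℝ :=
  ∑ j ∈ Finset.univ.filter (fun j : Fin K => (j : ℕ) ≤ k), α j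

/-- `S(α) = Σ_{r=0}^{K−2} c^r α_{≤K−2}^r / r!`. -/
noncomputable def thresholdS (c : ℝ) {K : ℕ} (α : Fin K → ℝ) : ℝ :=
  ∑ r ∈ Finset.range (K - 1), c ^ r * (partialSum α (K - 2)) ^ r / (Nat.factorial r)

/-- The limiting drift function `δ` of the Threshold model on `G(n, c/n)`. -/
noncomputable def thresholdDrift (c : ℝ) (K : ℕ) (α : Fin K → ℝ) (k : Fin K) : ℝ :=
  if (k : ℕ) = 0 then
    -c * α k * Real.exp (-c * partialSum α (K - 1)) * thresholdS c α
      + Real.exp (-c * partialSum α (K - 1))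
  else if (k : ℕ) = K - 1 then
    c * α ⟨K - 2, by have := k.isLt; omega⟩ * Real.exp (-c * partialSum α (K - 1))
        * thresholdS c α
      + Real.exp (-c * partialSum α (K - 1)) * c ^ (K - 1)
          * (partialSum α (K - 2)) ^ (K - 1) / (Nat.factorial (K - 1))
  else
    c * (α ⟨(k : ℕ) - 1, by have := k.isLt; omega⟩ - α k)
        * Real.exp (-c * partialSum α (K - 1)) * thresholdS c α
      + Real.exp (-c * partialSum α (K - 1)) * c ^ (k : ℕ)
          * (partialSum α (K - 2)) ^ (k : ℕ) / (Nat.factorial (k : ℕ))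

/-- `m(α) = ⌊nα_0⌋ + ⋯ + ⌊nα_{K−2}⌋`. -/
noncomputable def mFloor (n : ℕ) {K : ℕ} (α : Fin K → ℝ) : ℕ :=
  ∑ j ∈ Finset.univ.filter (fun j : Fin K => (j : ℕ) ≤ K - 2), ⌊(n : ℝ) * α j⌋₊

/-- The one-step drift function `δ^n = (δ^n_0, …, δ^n_{K−1})` of the exploration
algorithm for the Threshold model on the Erdős–Rényi graph `G(n, c/n)`, with
`p_n = c/n` and `m(α) = ⌊nα_0⌋ + ⋯ + ⌊nα_{K−2}⌋`:
`δ^n_0(α) = −⌊nα_0⌋ p_n (1−p_n)^{⌊nα_{K−1}⌋} B(m(α)−1, p_n; K−2)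
             + b(m(α), p_n; 0)(1−p_n)^{⌊nα_{K−1}⌋}`;
`δ^n_k(α) = (⌊nα_{k−1}⌋ − ⌊nα_k⌋) p_n (1−p_n)^{⌊nα_{K−1}⌋} B(m(α)−1, p_n; K−2)
             + b(m(α), p_n; k)(1−p_n)^{⌊nα_{K−1}⌋}` for `1 ≤ k ≤ K−2`;
`δ^n_{K−1}(α) = ⌊nα_{K−2}⌋ p_n (1−p_n)^{⌊nα_{K−1}⌋} B(m(α)−1, p_n; K−2)
             + b(m(α), p_n; K−1)(1−p_n)^{⌊nα_{K−1}⌋}`. -/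
noncomputable def thresholdDriftN (c : ℝ) (K : ℕ) (n : ℕ) (α : Fin K → ℝ) (k : Fin K) : ℝ :=
  if (k : ℕ) = 0 then
    -(⌊(n : ℝ) * α k⌋₊ : ℝ) * (c / n)
        * (1 - c / n) ^ ⌊(n : ℝ) * α ⟨K - 1, by have := k.isLt; omega⟩⌋₊
        * binomialCDFz ((mFloor n α : ℤ) - 1) (c / n) (K - 2)
      + binomialProb (mFloor n α) (c / n) 0
          * (1 - c / n) ^ ⌊(n : ℝ) * α ⟨K - 1, by have := k.isLt; omega⟩⌋₊
  else if (k : ℕ) = K - 1 then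
    (⌊(n : ℝ) * α ⟨K - 2, by have := k.isLt; omega⟩⌋₊ : ℝ) * (c / n)
        * (1 - c / n) ^ ⌊(n : ℝ) * α ⟨K - 1, by have := k.isLt; omega⟩⌋₊
        * binomialCDFz ((mFloor n α : ℤ) - 1) (c / n) (K - 2)
      + binomialProb (mFloor n α) (c / n) (K - 1)
          * (1 - c / n) ^ ⌊(n : ℝ) * α ⟨K - 1, by have := k.isLt; omega⟩⌋₊
  else
    ((⌊(n : ℝ) * α ⟨(k : ℕ) - 1, by have := k.isLt; omega⟩⌋₊ : ℝ)
          - (⌊(n : ℝ) * α k⌋₊ : ℝ)) * (c / n)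
        * (1 - c / n) ^ ⌊(n : ℝ) * α ⟨K - 1, by have := k.isLt; omega⟩⌋₊
        * binomialCDFz ((mFloor n α : ℤ) - 1) (c / n) (K - 2)
      + binomialProb (mFloor n α) (c / n) (k : ℕ)
          * (1 - c / n) ^ ⌊(n : ℝ) * α ⟨K - 1, by have := k.isLt; omega⟩⌋₊

/-- If `N / n → t` then also `(N - i) / n → t`, with truncated subtraction. -/
lemma tendsto_natSub_div {ι : Type*} {l : Filter ι} {n N : ι → ℕ} {t : ℝ}
    (hn : Tendsto n l atTop) (hN : Tendsto (fun y => (N y : ℝ) / n y) l (nhds t)) (i : ℕ) :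
    Tendsto (fun y => ((N y - i : ℕ) : ℝ) / n y) l (nhds t) := by
  have hn' : Tendsto (fun y => (n y : ℝ)) l atTop := tendsto_natCast_atTop_atTop.comp hn
  have hi : Tendsto (fun y => (N y : ℝ) / n y - (i : ℝ) / n y) l (nhds t) := by
    simpa using hN.sub (hn'.const_div_atTop (i : ℝ))
  refine tendsto_of_tendsto_of_tendsto_of_le_of_le hi hN (fun y => ?_) (fun y => ?_)
  · have h : (N y : ℝ) ≤ ((N y - i : ℕ) : ℝ) + i := by exact_mod_cast le_tsub_add
    change (N y : ℝ) / n y - (i : ℝ) / n y ≤ ((N y - i : ℕ) : ℝ) / n y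
    rw [← sub_div]
    gcongr
    linarith
  · change ((N y - i : ℕ) : ℝ) / n y ≤ (N y : ℝ) / n y
    gcongr
    exact Nat.sub_le _ _

/-- If `n → ∞` and `N / n → t` then `(1 - c / n) ^ N → exp (-c t)`. -/
lemma tendsto_one_sub_div_pow {ι : Type*} {l : Filter ι} {n N : ι → ℕ} {t : ℝ} (c : ℝ)
    (hn : Tendsto n l atTop) (hN : Tendsto (fun y => (N y : ℝ) / n y) l (nhds t)) :
    Tendsto (fun y => (1 - c / n y) ^ N y) l (nhds (Real.exp (-c * t))) := by
  have hn' : Tendsto (fun y => (n y : ℝ)) l atTop := tendsto_natCast_atTop_atTop.comp hn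
  have hlog := (Real.tendsto_mul_log_one_add_div_atTop (-c)).comp hn'
  refine (((hlog.mul hN).rexp)).congr' ?_
  filter_upwards [hn'.eventually_gt_atTop (max c 0)] with y hy
  have h0 : (0 : ℝ) < n y := (le_max_right _ _).trans_lt hy
  have hc : c < n y := (le_max_left _ _).trans_lt hy
  have h1 : 0 < 1 - c / n y := by rw [sub_pos, div_lt_one h0]; exact hc
  have h2 : (n y : ℝ) * Real.log (1 + -c / n y) * ((N y : ℝ) / n y)
      = N y * Real.log (1 - c / n y) := by
    rw [neg_div, ← sub_eq_add_neg]
    field_simp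
  simp only [Function.comp_apply]
  rw [h2, Real.exp_nat_mul, Real.exp_log h1]

/-- Poisson limit theorem: if `n → ∞` and `N / n → t` then
`b(N, c / n; k) → exp (-c t) (c t) ^ k / k!`. -/
lemma tendsto_binomialProb {ι : Type*} {l : Filter ι} {n N : ι → ℕ} {t : ℝ} (c : ℝ)
    (hn : Tendsto n l atTop) (hN : Tendsto (fun y => (N y : ℝ) / n y) l (nhds t)) (k : ℕ) :
    Tendsto (fun y => binomialProb (N y) (c / n y) k) l
      (nhds (Real.exp (-c * t) * (c ^ k * t ^ k / k.factorial))) := by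
  have hpow := tendsto_one_sub_div_pow c hn (tendsto_natSub_div hn hN k)
  have hprod : Tendsto (fun y => ∏ i ∈ range k, ((N y - i : ℕ) : ℝ) / n y) l
      (nhds (∏ _i ∈ range k, t)) :=
    tendsto_finsetProd _ fun i _ => tendsto_natSub_div hn hN i
  rw [prod_const, card_range] at hprod
  refine (hpow.mul ((hprod.const_mul (c ^ k)).div_const (k.factorial : ℝ))).congr fun y => ?_
  have hk : (k.factorial : ℝ) ≠ 0 := by exact_mod_cast k.factorial_ne_zero
  have hch : (k.factorial : ℝ) * (N y).choose k = ∏ i ∈ range k, ((N y - i : ℕ) : ℝ) := by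
    rw [← Nat.cast_prod, ← Nat.descFactorial_eq_prod_range,
      Nat.descFactorial_eq_factorial_mul_choose, Nat.cast_mul]
  rw [binomialProb, prod_div_distrib, prod_const, card_range, ← hch, div_pow]
  field_simp

/-- The convention `B(-1, p; k) = 1` agrees with truncated subtraction, as `B(0, p; k) = 1`. -/
lemma binomialCDFz_natCast_sub_one (m : ℕ) (p : ℝ) (k : ℕ) :
    binomialCDFz ((m : ℤ) - 1) p k = ∑ j ∈ range (k + 1), binomialProb (m - 1) p j := by
  rcases m with _ | m
  · rw [sum_range_succ']
    simp [binomialCDFz, binomialProb]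
  · simp [binomialCDFz, not_lt.2 (Int.natCast_nonneg m)]

lemma tendsto_binomialCDFz {ι : Type*} {l : Filter ι} {n N : ι → ℕ} {t : ℝ} (c : ℝ)
    (hn : Tendsto n l atTop) (hN : Tendsto (fun y => (N y : ℝ) / n y) l (nhds t)) (k : ℕ) :
    Tendsto (fun y => binomialCDFz ((N y : ℤ) - 1) (c / n y) k) l
      (nhds (Real.exp (-c * t) * ∑ r ∈ range (k + 1), c ^ r * t ^ r / r.factorial)) := by
  simp only [binomialCDFz_natCast_sub_one, mul_sum]
  exact tendsto_finsetSum _ fun r _ =>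
    tendsto_binomialProb c hn (tendsto_natSub_div hn hN 1) r

lemma tendsto_natFloor_mul_div {ι : Type*} {l : Filter ι} {n : ι → ℕ} {a : ι → ℝ} {t : ℝ}
    (hn : Tendsto n l atTop) (ha : Tendsto a l (nhds t)) (ha0 : ∀ᶠ y in l, 0 ≤ a y) :
    Tendsto (fun y => (⌊(n y : ℝ) * a y⌋₊ : ℝ) / n y) l (nhds t) := by
  have hn' : Tendsto (fun y => (n y : ℝ)) l atTop := tendsto_natCast_atTop_atTop.comp hn
  have hlow : Tendsto (fun y => a y - 1 / n y) l (nhds t) := by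
    simpa using ha.sub (hn'.const_div_atTop (1 : ℝ))
  refine tendsto_of_tendsto_of_tendsto_of_le_of_le' hlow ha ?_ ?_
  · filter_upwards [hn'.eventually_gt_atTop 0] with y hy
    rw [le_div_iff₀ hy, sub_mul, div_mul_cancel₀ _ hy.ne']
    linarith [Nat.lt_floor_add_one ((n y : ℝ) * a y)]
  · filter_upwards [hn'.eventually_gt_atTop 0, ha0] with y hy h0
    rw [div_le_iff₀ hy, mul_comm (a y)]
    exact Nat.floor_le (by positivity)

lemma partialSum_eq_add_last {K : ℕ} (hK : 2 ≤ K) (α : Fin K → ℝ) :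
    partialSum α (K - 1) = partialSum α (K - 2) + α ⟨K - 1, by omega⟩ := by
  have h : univ.filter (fun j : Fin K => (j : ℕ) ≤ K - 1)
      = insert ⟨K - 1, by omega⟩ (univ.filter fun j : Fin K => (j : ℕ) ≤ K - 2) := by
    ext j
    simp only [mem_filter, mem_univ, true_and, mem_insert, Fin.ext_iff]
    omega
  rw [partialSum, h, sum_insert (by simp; omega), add_comm, partialSum]

lemma continuous_partialSum {K : ℕ} (k : ℕ) :
    Continuous fun α : Fin K → ℝ => partialSum α k := by
  unfold partialSum
  fun_prop

lemma continuous_thresholdS (c : ℝ) {K : ℕ} :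
    Continuous fun α : Fin K → ℝ => thresholdS c α := by
  have := continuous_partialSum (K := K) (K - 2)
  unfold thresholdS
  fun_prop

lemma continuous_thresholdDrift (c : ℝ) (K : ℕ) : Continuous (thresholdDrift c K) := by
  refine continuous_pi fun k => ?_
  have h1 := continuous_partialSum (K := K) (K - 1)
  have h2 := continuous_partialSum (K := K) (K - 2)
  have h3 := continuous_thresholdS c (K := K)
  unfold thresholdDrift
  split_ifs <;> fun_prop

/-- If `n → ∞` and `α → x` with `α ≥ 0`, then `δ^n(α) → δ(x)`. -/
lemma tendsto_thresholdDriftN (c : ℝ) {K : ℕ} (hK : 2 ≤ K) {ι : Type*} {l : Filter ι}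
    {n : ι → ℕ} {α : ι → Fin K → ℝ} {x : Fin K → ℝ} (hn : Tendsto n l atTop)
    (hα : Tendsto α l (nhds x)) (hα0 : ∀ᶠ y in l, 0 ≤ α y) :
    Tendsto (fun y => thresholdDriftN c K (n y) (α y)) l (nhds (thresholdDrift c K x)) := by
  have hfl (j : Fin K) :
      Tendsto (fun y => (⌊(n y : ℝ) * α y j⌋₊ : ℝ) / n y) l (nhds (x j)) :=
    tendsto_natFloor_mul_div hn (tendsto_pi_nhds.1 hα j) (hα0.mono fun y hy => hy j)
  have hm : Tendsto (fun y => (mFloor (n y) (α y) : ℝ) / n y) l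
      (nhds (partialSum x (K - 2))) := by
    simp only [mFloor, Nat.cast_sum, sum_div]
    exact tendsto_finsetSum _ fun j _ => hfl j
  have hpow := tendsto_one_sub_div_pow c hn (hfl ⟨K - 1, by omega⟩)
  have hB := tendsto_binomialCDFz c hn hm (K - 2)
  have hb := tendsto_binomialProb c hn hm
  have hS : ∑ r ∈ range (K - 2 + 1), c ^ r * partialSum x (K - 2) ^ r / r.factorial
      = thresholdS c x := by
    rw [thresholdS, show K - 2 + 1 = K - 1 by omega]
  rw [hS] at hB
  have hexp : Real.exp (-c * partialSum x (K - 1))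
      = Real.exp (-c * partialSum x (K - 2)) * Real.exp (-c * x ⟨K - 1, by omega⟩) := by
    rw [partialSum_eq_add_last hK, mul_add, Real.exp_add]
  refine tendsto_pi_nhds.2 fun k => ?_
  unfold thresholdDriftN thresholdDrift
  split_ifs with h0 h1
  · convert ((((hfl k).neg.mul_const c).mul hpow).mul hB).add ((hb 0).mul hpow) using 2
    · ring
    · rw [hexp]
      simp
      ring
  · convert ((((hfl ⟨K - 2, by omega⟩).mul_const c).mul hpow).mul hB).add
      ((hb (K - 1)).mul hpow) using 2
    · ring
    · rw [hexp]
      ring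
  · convert (((((hfl ⟨(k : ℕ) - 1, by omega⟩).sub (hfl k)).mul_const c).mul hpow).mul hB).add
      ((hb k).mul hpow) using 2
    · ring
    · rw [hexp]
      ring

/-- For `c > 0` and `K ≥ 2`, the drift functions `δ^n` of the Threshold exploration
algorithm converge uniformly on `[0,1]^K` (in the sup-norm) to the limiting drift `δ`
as `n → ∞`. -/
theorem thresholdDriftN_tendstoUniformlyOn (c : ℝ) (hc : 0 < c) (K : ℕ) (hK : 2 ≤ K) :
    TendstoUniformlyOn (fun (n : ℕ) (α : Fin K → ℝ) => thresholdDriftN c K n α)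
      (thresholdDrift c K) atTop (Set.Icc (0 : Fin K → ℝ) 1) := by
  refine (tendstoLocallyUniformlyOn_iff_tendstoUniformlyOn_of_compact isCompact_Icc).1 ?_
  refine tendstoLocallyUniformlyOn_iff_forall_tendsto.2 fun x _ => ?_
  have hα : Tendsto (fun y : ℕ × (Fin K → ℝ) => y.2)
      (atTop ×ˢ nhdsWithin x (Set.Icc 0 1)) (nhdsWithin x (Set.Icc 0 1)) := tendsto_snd
  have hα' := hα.mono_right nhdsWithin_le_nhds
  have hα0 : ∀ᶠ y : ℕ × (Fin K → ℝ) in atTop ×ˢ nhdsWithin x (Set.Icc 0 1), 0 ≤ y.2 :=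
    (hα.eventually self_mem_nhdsWithin).mono fun y hy => hy.1
  exact ((((continuous_thresholdDrift c K).tendsto x).comp hα').prodMk_nhds
    (tendsto_thresholdDriftN c hK tendsto_fst hα' hα0)).mono_right (nhds_le_uniformity _)
end

section
/- Fix c > 0 and an integer K ≥ 2, and let δ : [0,1]^K → ℝ^K be the Threshold drift function: δ_0(α) = −c α_0 e^{−c α_{≤K−1}} S(α) + e^{−c α_{≤K−1}}; δ_k(α) = c(α_{k−1} − α_k) e^{−c α_{≤K−1}} S(α) + e^{−c α_{≤K−1}} c^k α_{≤K−2}^k / k! for 1 ≤ k ≤ K−2; δ_{K−1}(α) = c α_{K−2} e^{−c α_{≤K−1}} S(α) + e^{−c α_{≤K−1}} c^{K−1} α_{≤K−2}^{K−1} / (K−1)!. Then there exists exactly one continuous function α : [0,1] → [0,1]^K satisfying the integral equation α_k(t) = ∫_0^t δ_k(α(s)) ds for all t ∈ [0,1] and all 0 ≤ k ≤ K−1. -/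
open Finset

/-- A continuous `[0,1]^K`-valued solution on `[0,1]` of the integral equation
`α_k(t) = ∫_0^t δ_k(α(s)) ds` for the Threshold drift `δ`. -/
def IsThresholdSolution (c : ℝ) (K : ℕ) (α : ℝ → Fin K → ℝ) : Prop :=
  ContinuousOn α (Set.Icc 0 1) ∧
  (∀ t ∈ Set.Icc (0 : ℝ) 1, α t ∈ Set.Icc (0 : Fin K → ℝ) 1) ∧
  (∀ t ∈ Set.Icc (0 : ℝ) 1, ∀ k : Fin K,
    α t k = ∫ s in (0 : ℝ)..t, thresholdDrift c K (α s) k)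

lemma contDiff_partialSum {K : ℕ} (k : ℕ) :
    ContDiff ℝ 1 (fun x : Fin K → ℝ => partialSum x k) := by
  unfold partialSum
  fun_prop

lemma contDiff_thresholdS (c : ℝ) (K : ℕ) :
    ContDiff ℝ 1 (fun x : Fin K → ℝ => thresholdS c x) := by
  unfold thresholdS
  have := contDiff_partialSum (K := K) (K - 2)
  fun_prop

lemma contDiff_thresholdDrift (c : ℝ) (K : ℕ) : ContDiff ℝ 1 (thresholdDrift c K) := by
  have h₁ := contDiff_partialSum (K := K) (K - 1)
  have h₂ := contDiff_partialSum (K := K) (K - 2)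
  have h₃ := contDiff_thresholdS c K
  refine contDiff_pi.2 fun k => ?_
  unfold thresholdDrift
  split_ifs <;> fun_prop

lemma partialSum_nonneg {K : ℕ} {x : Fin K → ℝ} (hx : 0 ≤ x) (k : ℕ) : 0 ≤ partialSum x k :=
  sum_nonneg fun i _ => hx i

lemma thresholdS_nonneg {c : ℝ} (hc : 0 ≤ c) {K : ℕ} {x : Fin K → ℝ} (hx : 0 ≤ x) :
    0 ≤ thresholdS c x := by
  have := partialSum_nonneg hx (K - 2)
  exact sum_nonneg fun r _ => by positivity

/-- On the nonnegative orthant the drift points inwards at the coordinate hyperplanes. -/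
lemma thresholdDrift_nonneg_of_eq_zero {c : ℝ} (hc : 0 ≤ c) {K : ℕ} (hK : 2 ≤ K)
    {x : Fin K → ℝ} (hx : 0 ≤ x) {k : Fin K} (hk : x k = 0) : 0 ≤ thresholdDrift c K x k := by
  have hA := partialSum_nonneg hx (K - 2)
  have hS := thresholdS_nonneg hc hx
  unfold thresholdDrift
  split_ifs
  · rw [hk, mul_zero, zero_mul, zero_mul, zero_add]
    positivity
  · have := hx ⟨K - 2, by omega⟩
    simp only [Pi.zero_apply] at this
    positivity
  · have := hx ⟨(k : ℕ) - 1, by omega⟩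
    simp only [Pi.zero_apply] at this
    rw [hk, sub_zero]
    positivity

/-- The drift written as an inflow minus an outflow plus a source term. -/
lemma thresholdDrift_eq_flow (c : ℝ) (m : ℕ) (x : Fin (m + 2) → ℝ) (k : Fin (m + 2)) :
    thresholdDrift c (m + 2) x k =
      Real.exp (-c * partialSum x (m + 1)) *
        (c * thresholdS c x *
            ((Fin.cases 0 (fun i : Fin (m + 1) => x i.castSucc) k : ℝ)
              - (Fin.lastCases 0 (fun i : Fin (m + 1) => x i.castSucc) k : ℝ))
          + (c * partialSum x m) ^ (k : ℕ) / (Nat.factorial (k : ℕ))) := by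
  unfold thresholdDrift
  rw [mul_pow]
  split_ifs with h0 h1
  · obtain rfl : k = Fin.castSucc 0 := Fin.ext h0
    simp only [Fin.lastCases_castSucc]
    simp
    ring
  · obtain rfl : k = Fin.succ (Fin.last m) := Fin.ext (by simpa using h1)
    simp only [Fin.cases_succ]
    rw [Fin.succ_last, Fin.lastCases_last]
    simp only [Fin.val_last, Nat.add_sub_cancel, Nat.add_succ_sub_one, Nat.succ_eq_add_one]
    have : (⟨m, by omega⟩ : Fin (m + 2)) = (Fin.last m).castSucc := rfl
    rw [this]
    ring
  · obtain ⟨i, rfl⟩ := Fin.exists_succ_eq.2 (fun h => h0 (by simp [h]) : k ≠ 0)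
    obtain ⟨j, hj⟩ := Fin.exists_castSucc_eq.2
      (fun h => h1 (by simp [h]) : i.succ ≠ Fin.last (m + 1))
    simp only [Fin.cases_succ]
    rw [← hj, Fin.lastCases_castSucc, hj]
    have : (⟨(i.succ : ℕ) - 1, by omega⟩ : Fin (m + 2)) = i.castSucc := by ext; simp
    rw [this]
    simp only [Nat.add_sub_cancel, Nat.add_succ_sub_one]
    ring

/-- On the nonnegative orthant the total drift is at most one. -/
lemma sum_thresholdDrift_le_one {c : ℝ} (hc : 0 ≤ c) {K : ℕ} (hK : 2 ≤ K) {x : Fin K → ℝ}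
    (hx : 0 ≤ x) : ∑ k, thresholdDrift c K x k ≤ 1 := by
  obtain ⟨m, rfl⟩ := Nat.exists_eq_add_of_le' hK
  have hA := partialSum_nonneg hx m
  have hle : partialSum x m ≤ partialSum x (m + 1) := by
    refine sum_le_sum_of_subset_of_nonneg (fun i hi => ?_) fun i _ _ => hx i
    simp only [mem_filter, mem_univ, true_and] at hi ⊢
    omega
  have hflow : ∑ k : Fin (m + 2), ((Fin.cases 0 (fun i : Fin (m + 1) => x i.castSucc) k : ℝ)
      - (Fin.lastCases 0 (fun i : Fin (m + 1) => x i.castSucc) k : ℝ)) = 0 := by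
    rw [sum_sub_distrib, Fin.sum_univ_succ, Fin.sum_univ_castSucc (n := m + 1)
      (f := fun k => (Fin.lastCases 0 (fun i : Fin (m + 1) => x i.castSucc) k : ℝ))]
    simp
  simp_rw [thresholdDrift_eq_flow]
  rw [← mul_sum, sum_add_distrib, ← mul_sum, hflow, mul_zero, zero_add,
    Fin.sum_univ_eq_sum_range (fun k => (c * partialSum x m) ^ k / (Nat.factorial k : ℝ))]
  calc _ ≤ Real.exp (-c * partialSum x (m + 1)) * Real.exp (c * partialSum x (m + 1)) := by
        gcongr
        exact (Real.sum_le_exp_of_nonneg (by positivity) _).trans (by gcongr)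
    _ = 1 := by rw [← Real.exp_add]; simp

/-- The coordinatewise projection of `ℝ^K` onto the cube `[0,1]^K`. -/
noncomputable def clampCube {K : ℕ} (x : Fin K → ℝ) : Fin K → ℝ :=
  fun k => max 0 (min 1 (x k))

lemma clampCube_mem {K : ℕ} (x : Fin K → ℝ) : clampCube x ∈ Set.Icc (0 : Fin K → ℝ) 1 :=
  ⟨fun _ => le_max_left _ _, fun _ => max_le zero_le_one (min_le_left _ _)⟩

lemma clampCube_of_mem {K : ℕ} {x : Fin K → ℝ} (hx : x ∈ Set.Icc (0 : Fin K → ℝ) 1) :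
    clampCube x = x := by
  ext k
  have h₀ := hx.1 k
  have h₁ := hx.2 k
  simp only [Pi.zero_apply, Pi.one_apply] at h₀ h₁
  simp [clampCube, h₀, h₁]

lemma lipschitzWith_clampCube (K : ℕ) : LipschitzWith 1 (clampCube (K := K)) :=
  LipschitzWith.of_dist_le_mul fun x y => by
    refine (dist_pi_le_iff (by positivity)).2 fun k => ?_
    simpa [clampCube] using
      (((LipschitzWith.eval (α := fun _ : Fin K => ℝ) k).const_min 1).const_max 0).dist_le_mul x y

lemma exists_lipschitzOnWith_thresholdDrift (c : ℝ) (K : ℕ) :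
    ∃ L, LipschitzOnWith L (thresholdDrift c K) (Set.Icc 0 1) :=
  (contDiff_thresholdDrift c K).locallyLipschitz.locallyLipschitzOn.exists_lipschitzOnWith_of_compact
    isCompact_Icc

lemma hasDerivWithinAt_integral_Icc {f : ℝ → ℝ} {a b t : ℝ} (hf : ContinuousOn f (Set.Icc a b))
    (ht : t ∈ Set.Icc a b) :
    HasDerivWithinAt (fun u => ∫ s in a..u, f s) (f t) (Set.Icc a b) t := by
  have : Fact (t ∈ Set.Icc a b) := ⟨ht⟩
  refine intervalIntegral.integral_hasDerivWithinAt_right ?_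
    (hf.stronglyMeasurableAtFilter_nhdsWithin measurableSet_Icc t) (hf t ht)
  refine (hf.mono ?_).intervalIntegrable
  rw [Set.uIcc_of_le ht.1]
  exact Set.Icc_subset_Icc_right ht.2

lemma HasDerivWithinAt.Ici_of_Icc {E : Type*} [NormedAddCommGroup E] [NormedSpace ℝ E]
    {f : ℝ → E} {f' : E} {a b t : ℝ} (h : HasDerivWithinAt f f' (Set.Icc a b) t)
    (ht : t ∈ Set.Ico a b) : HasDerivWithinAt f f' (Set.Ici t) t :=
  h.mono_of_mem_nhdsWithin
    (Filter.mem_of_superset (Icc_mem_nhdsGE ht.2) (Set.Icc_subset_Icc_left ht.1))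

/-- A function starting at zero whose derivative is nonnegative wherever the function is
nonpositive stays nonnegative. -/
lemma nonneg_of_deriv_nonneg_of_nonpos {f f' : ℝ → ℝ} {a b : ℝ}
    (hf : ∀ t ∈ Set.Icc a b, HasDerivWithinAt f (f' t) (Set.Icc a b) t) (ha : f a = 0)
    (hf' : ∀ t ∈ Set.Icc a b, f t ≤ 0 → 0 ≤ f' t) {t : ℝ} (ht : t ∈ Set.Icc a b) : 0 ≤ f t := by
  have key : ∀ ε > 0, -f t ≤ ε * (1 + (t - a)) := fun ε hε => by
    refine image_le_of_deriv_right_lt_deriv_boundary (f := fun t => -f t) (f' := fun t => -f' t)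
      (B := fun t => ε * (1 + (t - a))) (B' := fun _ => ε)
      (fun s hs => (hf s hs).continuousWithinAt.neg)
      (fun s hs => ((hf s (Set.Ico_subset_Icc_self hs)).Ici_of_Icc hs).neg) ?_ (fun s => ?_)
      (fun s hs h => ?_) ht
    · simp [ha, hε.le]
    · simpa using (((hasDerivAt_id s).sub_const a).const_add 1).const_mul ε
    · have : 0 < ε * (1 + (s - a)) := mul_pos hε (by linarith [hs.1])
      linarith [hf' s (Set.Ico_subset_Icc_self hs) (by linarith)]
  have hpos : 0 < 1 + (t - a) := by linarith [ht.1]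
  by_contra! hneg
  have := key (-f t / (2 * (1 + (t - a)))) (div_pos (by linarith) (by linarith))
  rw [div_mul_eq_mul_div, le_div_iff₀ (by linarith)] at this
  nlinarith

lemma IsThresholdSolution.hasDerivWithinAt {c : ℝ} {K : ℕ} {α : ℝ → Fin K → ℝ}
    (h : IsThresholdSolution c K α) {t : ℝ} (ht : t ∈ Set.Icc (0 : ℝ) 1) :
    HasDerivWithinAt α (thresholdDrift c K (α t)) (Set.Icc 0 1) t := by
  have hcont := (contDiff_thresholdDrift c K).continuous.comp_continuousOn h.1
  refine hasDerivWithinAt_pi.2 fun k => ?_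
  exact (hasDerivWithinAt_integral_Icc (continuousOn_pi.1 hcont k) ht).congr
    (fun s hs => h.2.2 s hs k) (h.2.2 t ht k)

lemma IsThresholdSolution.eqOn {c : ℝ} {K : ℕ} {α β : ℝ → Fin K → ℝ}
    (hα : IsThresholdSolution c K α) (hβ : IsThresholdSolution c K β) :
    Set.EqOn α β (Set.Icc 0 1) := by
  obtain ⟨L, hL⟩ := exists_lipschitzOnWith_thresholdDrift c K
  refine ODE_solution_unique_of_mem_Icc_right (v := fun _ => thresholdDrift c K)
    (s := fun _ => Set.Icc 0 1) (fun _ _ => hL)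
    hα.1 (fun t ht => (hα.hasDerivWithinAt (Set.Ico_subset_Icc_self ht)).Ici_of_Icc ht)
    (fun t ht => hα.2.1 t (Set.Ico_subset_Icc_self ht))
    hβ.1 (fun t ht => (hβ.hasDerivWithinAt (Set.Ico_subset_Icc_self ht)).Ici_of_Icc ht)
    (fun t ht => hβ.2.1 t (Set.Ico_subset_Icc_self ht)) ?_
  ext k
  rw [hα.2.2 0 (by simp) k, hβ.2.2 0 (by simp) k]
  simp

/-- The drift precomposed with the projection onto the cube has a solution on `[0,1]` started
at the origin. -/
lemma exists_solution_clampCube (c : ℝ) (K : ℕ) :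
    ∃ α : ℝ → Fin K → ℝ, α 0 = 0 ∧ ∀ t ∈ Set.Icc (0 : ℝ) 1,
      HasDerivWithinAt α (thresholdDrift c K (clampCube (α t))) (Set.Icc 0 1) t := by
  obtain ⟨L, hL⟩ := exists_lipschitzOnWith_thresholdDrift c K
  obtain ⟨M, hM⟩ := isCompact_Icc.exists_bound_of_continuousOn
    (contDiff_thresholdDrift c K).continuous.continuousOn (s := Set.Icc (0 : Fin K → ℝ) 1)
  have hlip : LipschitzWith (L * 1) (fun x => thresholdDrift c K (clampCube x)) :=
    lipschitzOnWith_univ.1 (hL.comp (lipschitzWith_clampCube K).lipschitzOnWith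
      fun x _ => clampCube_mem x)
  have hpl : IsPicardLindelof (fun _ x => thresholdDrift c K (clampCube x))
      (⟨0, by simp⟩ : Set.Icc (0 : ℝ) 1) 0 M.toNNReal 0 M.toNNReal (L * 1) :=
    .of_time_independent
      (fun x _ => (hM _ (clampCube_mem x)).trans (Real.le_coe_toNNReal M))
      hlip.lipschitzOnWith (by simp)
  exact hpl.exists_eq_forall_mem_Icc_hasDerivWithinAt₀

lemma exists_isThresholdSolution {c : ℝ} (hc : 0 ≤ c) {K : ℕ} (hK : 2 ≤ K) :
    ∃ α : ℝ → Fin K → ℝ, IsThresholdSolution c K α := by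
  obtain ⟨α, h0, hα⟩ := exists_solution_clampCube c K
  have hαk (k : Fin K) : ∀ t ∈ Set.Icc (0 : ℝ) 1, HasDerivWithinAt (fun t => α t k)
      (thresholdDrift c K (clampCube (α t)) k) (Set.Icc 0 1) t :=
    fun t ht => hasDerivWithinAt_pi.1 (hα t ht) k
  have hcont : ContinuousOn α (Set.Icc 0 1) := fun t ht => (hα t ht).continuousWithinAt
  have hnonneg : ∀ t ∈ Set.Icc (0 : ℝ) 1, 0 ≤ α t := fun t ht k =>
    nonneg_of_deriv_nonneg_of_nonpos (hαk k) (by simp [h0])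
      (fun s _ hs => thresholdDrift_nonneg_of_eq_zero hc hK (clampCube_mem _).1
        (max_eq_left ((min_le_right _ _).trans hs))) ht
  have hsum : ∀ t ∈ Set.Icc (0 : ℝ) 1, ∑ k, α t k ≤ t := fun t ht => by
    have hd : ∀ t ∈ Set.Icc (0 : ℝ) 1, HasDerivWithinAt (fun t => ∑ k, α t k)
        (∑ k, thresholdDrift c K (clampCube (α t)) k) (Set.Icc 0 1) t :=
      fun t ht => HasDerivWithinAt.fun_sum fun k _ => hαk k t ht
    exact image_le_of_deriv_right_le_deriv_boundary (B := id) (B' := fun _ => 1)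
      (fun s hs => (hd s hs).continuousWithinAt)
      (fun s hs => (hd s (Set.Ico_subset_Icc_self hs)).Ici_of_Icc hs) (by simp [h0])
      continuousOn_id (fun s _ => hasDerivWithinAt_id s _)
      (fun s _ => sum_thresholdDrift_le_one hc hK (clampCube_mem _).1) ht
  have hmem : ∀ t ∈ Set.Icc (0 : ℝ) 1, α t ∈ Set.Icc (0 : Fin K → ℝ) 1 := fun t ht =>
    ⟨hnonneg t ht, fun k => (single_le_sum (fun i _ => hnonneg t ht i) (mem_univ k)).trans
      ((hsum t ht).trans ht.2)⟩
  refine ⟨α, hcont, hmem, fun t ht k => ?_⟩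
  have hsub : Set.Icc 0 t ⊆ Set.Icc (0 : ℝ) 1 := Set.Icc_subset_Icc_right ht.2
  have hdrift : ContinuousOn (fun s => thresholdDrift c K (α s) k) (Set.Icc 0 1) :=
    continuousOn_pi.1 ((contDiff_thresholdDrift c K).continuous.comp_continuousOn hcont) k
  have := intervalIntegral.integral_eq_sub_of_hasDeriv_right_of_le (f := fun t => α t k) ht.1
    ((continuousOn_pi.1 hcont k).mono hsub)
    (fun s hs => by
      have hs' : s ∈ Set.Ico (0 : ℝ) 1 := ⟨hs.1.le, hs.2.trans_le ht.2⟩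
      have h := ((hαk k s (Set.Ico_subset_Icc_self hs')).Ici_of_Icc hs').mono Set.Ioi_subset_Ici_self
      rwa [clampCube_of_mem (hmem s (Set.Ico_subset_Icc_self hs'))] at h)
    ((hdrift.mono (by rwa [Set.uIcc_of_le ht.1])).intervalIntegrable)
  simp [this, h0]


/-- For `c > 0` and `K ≥ 2` there is exactly one continuous function
`α : [0,1] → [0,1]^K` satisfying `α_k(t) = ∫_0^t δ_k(α(s)) ds` for all `t ∈ [0,1]`
and all `0 ≤ k ≤ K−1`, where `δ` is the Threshold drift function. -/
theorem thresholdDrift_existsUnique_solution (c : ℝ) (hc : 0 < c) (K : ℕ) (hK : 2 ≤ K) :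
    (∃ α : ℝ → Fin K → ℝ, IsThresholdSolution c K α) ∧
    (∀ α β : ℝ → Fin K → ℝ, IsThresholdSolution c K α → IsThresholdSolution c K β →
      Set.EqOn α β (Set.Icc 0 1)) := by
  exact ⟨exists_isThresholdSolution hc.le hK, fun _ _ hα hβ => hα.eqOn hβ⟩
end

section
/- Fix c > 0 and an integer K ≥ 1, and let δ : [0,1]^K → ℝ^K be given by δ_1(α) = e^{−c(α_1 + ⋯ + α_K)} and δ_k(α) = (1 − e^{−c α_{k−1}}) e^{−c(α_k + ⋯ + α_K)} for 2 ≤ k ≤ K. Then there exists exactly one continuous function α : [0,1] → [0,1]^K satisfying α_k(t) = ∫_0^t δ_k(α(s)) ds for all t ∈ [0,1] and all 1 ≤ k ≤ K. -/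
open Finset

/-- The limiting drift function `δ = (δ_1, …, δ_K)` of the Tetris model on the
Erdős–Rényi graph `G(n, c/n)`. Heights `1, …, K` are indexed by `k : Fin K`
(with `k` representing height `k + 1`):
`δ_1(α) = e^{−c(α_1 + ⋯ + α_K)}` and
`δ_k(α) = (1 − e^{−c α_{k−1}}) e^{−c(α_k + ⋯ + α_K)}` for `2 ≤ k ≤ K`. -/
noncomputable def tetrisDrift (c : ℝ) (K : ℕ) (α : Fin K → ℝ) (k : Fin K) : ℝ :=
  if (k : ℕ) = 0 then
    Real.exp (-c * ∑ j, α j)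
  else
    (1 - Real.exp (-c * α ⟨(k : ℕ) - 1, by have := k.isLt; omega⟩)) *
      Real.exp (-c * ∑ j ∈ Finset.univ.filter (fun j : Fin K => (k : ℕ) ≤ (j : ℕ)), α j)

/-- A continuous `[0,1]^K`-valued solution on `[0,1]` of the integral equation
`α_k(t) = ∫_0^t δ_k(α(s)) ds` for the Tetris drift `δ`. -/
def IsTetrisSolution (c : ℝ) (K : ℕ) (α : ℝ → Fin K → ℝ) : Prop :=
  ContinuousOn α (Set.Icc 0 1) ∧
  (∀ t ∈ Set.Icc (0 : ℝ) 1, α t ∈ Set.Icc (0 : Fin K → ℝ) 1) ∧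
  (∀ t ∈ Set.Icc (0 : ℝ) 1, ∀ k : Fin K,
    α t k = ∫ s in (0 : ℝ)..t, tetrisDrift c K (α s) k)

/-- Coordinatewise truncation to the unit cube. -/
noncomputable def cubeClamp {ι : Type*} (x : ι → ℝ) : ι → ℝ := fun i ↦ max 0 (min 1 (x i))

lemma cubeClamp_mem {ι : Type*} (x : ι → ℝ) : cubeClamp x ∈ Set.Icc (0 : ι → ℝ) 1 :=
  ⟨fun _ ↦ le_max_left _ _, fun _ ↦ max_le zero_le_one (min_le_left _ _)⟩

lemma cubeClamp_eq_self {ι : Type*} {x : ι → ℝ} (hx : x ∈ Set.Icc (0 : ι → ℝ) 1) :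
    cubeClamp x = x := by
  ext i
  exact (congrArg (max 0) (min_eq_right (hx.2 i))).trans (max_eq_right (hx.1 i))

lemma lipschitzWith_cubeClamp {ι : Type*} [Fintype ι] :
    LipschitzWith 1 (cubeClamp : (ι → ℝ) → ι → ℝ) :=
  LipschitzWith.of_dist_le_mul fun x y ↦ (dist_pi_le_iff (by positivity)).2 fun i ↦
    ((((LipschitzWith.eval i).const_min 1).const_max 0).dist_le_mul x y)

/-- The fundamental theorem of calculus on `[0, 1]` for a one-sided derivative at the endpoints. -/
lemma integral_eq_sub_of_hasDerivWithinAt_Icc {f g : ℝ → ℝ}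
    (hf : ∀ t ∈ Set.Icc (0 : ℝ) 1, HasDerivWithinAt f (g t) (Set.Icc 0 1) t)
    (hg : ContinuousOn g (Set.Icc 0 1)) {t : ℝ} (ht : t ∈ Set.Icc (0 : ℝ) 1) :
    ∫ s in (0 : ℝ)..t, g s = f t - f 0 := by
  have hsub : Set.Icc 0 t ⊆ Set.Icc (0 : ℝ) 1 := Set.Icc_subset_Icc_right ht.2
  refine intervalIntegral.integral_eq_sub_of_hasDerivAt_of_le ht.1
    (fun s hs ↦ ((hf s (hsub hs)).continuousWithinAt).mono hsub) (fun s hs ↦ ?_)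
    ((hg.mono hsub).intervalIntegrable_of_Icc ht.1)
  exact (hf s (hsub (Set.Ioo_subset_Icc_self hs))).hasDerivAt
    (Icc_mem_nhds hs.1 (hs.2.trans_le ht.2))

/-- An integral curve in the unit cube started at the origin exists up to time one when the vector field is
Lipschitz on the cube and takes values in the cube. -/
theorem exists_integralCurve_of_mapsTo_cube {ι : Type*} [Fintype ι] {v : (ι → ℝ) → ι → ℝ}
    {L : NNReal} (hL : LipschitzOnWith L v (Set.Icc 0 1))
    (hv : Set.MapsTo v (Set.Icc 0 1) (Set.Icc 0 1)) :
    ∃ α : ℝ → ι → ℝ, ContinuousOn α (Set.Icc 0 1) ∧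
      (∀ t ∈ Set.Icc (0 : ℝ) 1, α t ∈ Set.Icc (0 : ι → ℝ) 1) ∧
      ∀ t ∈ Set.Icc (0 : ℝ) 1, ∀ i, α t i = ∫ s in (0 : ℝ)..t, v (α s) i := by
  have hclamp (x : ι → ℝ) : v (cubeClamp x) ∈ Set.Icc (0 : ι → ℝ) 1 := hv (cubeClamp_mem x)
  have hlip : LipschitzWith L (fun x ↦ v (cubeClamp x)) := by
    have := hL.comp (lipschitzWith_cubeClamp.lipschitzOnWith (s := Set.univ))
      (fun x _ ↦ cubeClamp_mem x)
    rwa [mul_one, lipschitzOnWith_univ] at this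
  have hPL : IsPicardLindelof (fun _ x ↦ v (cubeClamp x))
      (⟨0, by simp⟩ : Set.Icc (0 : ℝ) 1) (0 : ι → ℝ) 1 0 1 L :=
    .of_time_independent
      (fun x _ ↦ (pi_norm_le_iff_of_nonneg zero_le_one).2 fun i ↦ by
        rw [Real.norm_of_nonneg ((hclamp x).1 i)]; exact (hclamp x).2 i)
      hlip.lipschitzOnWith (by simp)
  obtain ⟨α, h0, hα⟩ := hPL.exists_eq_forall_mem_Icc_hasDerivWithinAt₀
  have hcont : ContinuousOn α (Set.Icc 0 1) := fun t ht ↦ (hα t ht).continuousWithinAt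
  have hvcont (i : ι) : ContinuousOn (fun s ↦ v (cubeClamp (α s)) i) (Set.Icc 0 1) :=
    (continuous_apply i).comp_continuousOn (hlip.continuous.comp_continuousOn hcont)
  have hint {t : ℝ} (ht : t ∈ Set.Icc (0 : ℝ) 1) (i : ι) :
      ∫ s in (0 : ℝ)..t, v (cubeClamp (α s)) i = α t i := by
    have := integral_eq_sub_of_hasDerivWithinAt_Icc
      (fun s hs ↦ hasDerivWithinAt_pi.1 (hα s hs) i) (hvcont i) ht
    simpa [show α 0 = 0 from h0] using this
  have hmem : ∀ t ∈ Set.Icc (0 : ℝ) 1, α t ∈ Set.Icc (0 : ι → ℝ) 1 := by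
    refine fun t ht ↦ ⟨fun i ↦ ?_, fun i ↦ ?_⟩ <;> rw [← hint ht i]
    · exact intervalIntegral.integral_nonneg ht.1 fun s _ ↦ (hclamp (α s)).1 i
    · calc ∫ s in (0 : ℝ)..t, v (cubeClamp (α s)) i ≤ ∫ _ in (0 : ℝ)..t, (1 : ℝ) :=
            intervalIntegral.integral_mono_on ht.1
              (((hvcont i).mono (Set.Icc_subset_Icc_right ht.2)).intervalIntegrable_of_Icc ht.1)
              intervalIntegrable_const fun s _ ↦ (hclamp (α s)).2 i
        _ ≤ 1 := by simpa using ht.2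
  refine ⟨α, hcont, hmem, fun t ht i ↦ ?_⟩
  rw [← hint ht i]
  refine intervalIntegral.integral_congr fun s hs ↦ ?_
  rw [Set.uIcc_of_le ht.1] at hs
  simp only [cubeClamp_eq_self (hmem s ⟨hs.1, hs.2.trans ht.2⟩)]

lemma contDiff_tetrisDrift (c : ℝ) (K : ℕ) : ContDiff ℝ 1 (tetrisDrift c K) := by
  refine contDiff_pi.2 fun k ↦ ?_
  unfold tetrisDrift
  split_ifs <;> fun_prop

lemma exists_lipschitzOnWith_tetrisDrift (c : ℝ) (K : ℕ) :
    ∃ L, LipschitzOnWith L (tetrisDrift c K) (Set.Icc 0 1) :=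
  (contDiff_tetrisDrift c K).contDiffOn.exists_lipschitzOnWith one_ne_zero (convex_Icc 0 1)
    isCompact_Icc

lemma mapsTo_tetrisDrift {c : ℝ} (hc : 0 ≤ c) (K : ℕ) :
    Set.MapsTo (tetrisDrift c K) (Set.Icc 0 1) (Set.Icc 0 1) := by
  intro x hx
  have hexp {y : ℝ} (hy : 0 ≤ y) : Real.exp (-c * y) ≤ 1 :=
    Real.exp_le_one_iff.2 (by nlinarith)
  have hsum (s : Finset (Fin K)) : 0 ≤ ∑ j ∈ s, x j := Finset.sum_nonneg fun j _ ↦ hx.1 j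
  refine ⟨fun k ↦ ?_, fun k ↦ ?_⟩ <;> simp only [tetrisDrift, Pi.zero_apply, Pi.one_apply] <;>
    split_ifs
  · positivity
  · exact mul_nonneg (sub_nonneg.2 (hexp (hx.1 _))) (Real.exp_nonneg _)
  · exact hexp (hsum _)
  · exact mul_le_one₀ (sub_le_self _ (Real.exp_nonneg _)) (Real.exp_nonneg _) (hexp (hsum _))

lemma IsTetrisSolution.hasDerivWithinAt {c : ℝ} {K : ℕ} {α : ℝ → Fin K → ℝ}
    (hα : IsTetrisSolution c K α) {t : ℝ} (ht : t ∈ Set.Ico (0 : ℝ) 1) :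
    HasDerivWithinAt α (tetrisDrift c K (α t)) (Set.Ici t) t := by
  have ht' := Set.Ico_subset_Icc_self ht
  refine hasDerivWithinAt_pi.2 fun k ↦ ?_
  have hcont : ContinuousOn (fun s ↦ tetrisDrift c K (α s) k) (Set.Icc 0 1) :=
    (continuous_apply k).comp_continuousOn
      ((contDiff_tetrisDrift c K).continuous.comp_continuousOn hα.1)
  have : Fact (t ∈ Set.Icc (0 : ℝ) 1) := ⟨ht'⟩
  have hderiv : HasDerivWithinAt (fun u ↦ ∫ s in (0 : ℝ)..u, tetrisDrift c K (α s) k)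
      (tetrisDrift c K (α t) k) (Set.Icc 0 1) t :=
    intervalIntegral.integral_hasDerivWithinAt_right
      ((hcont.mono (Set.Icc_subset_Icc_right ht'.2)).intervalIntegrable_of_Icc ht'.1)
      (hcont.stronglyMeasurableAtFilter_nhdsWithin measurableSet_Icc t) (hcont t ht')
  exact (hderiv.congr (fun s hs ↦ hα.2.2 s hs k) (hα.2.2 t ht' k)).mono_of_mem_nhdsWithin
    (Filter.mem_of_superset (Icc_mem_nhdsGE ht.2) (Set.Icc_subset_Icc_left ht.1))

/-- For `c > 0` and `K ≥ 1` there is exactly one continuous function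
`α : [0,1] → [0,1]^K` satisfying `α_k(t) = ∫_0^t δ_k(α(s)) ds` for all `t ∈ [0,1]`
and all `1 ≤ k ≤ K`, where `δ` is the Tetris drift function. -/
theorem tetrisDrift_existsUnique_solution (c : ℝ) (hc : 0 < c) (K : ℕ) (hK : 1 ≤ K) :
    (∃ α : ℝ → Fin K → ℝ, IsTetrisSolution c K α) ∧
    (∀ α β : ℝ → Fin K → ℝ, IsTetrisSolution c K α → IsTetrisSolution c K β →
      Set.EqOn α β (Set.Icc 0 1)) := by
  obtain ⟨L, hL⟩ := exists_lipschitzOnWith_tetrisDrift c K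
  refine ⟨exists_integralCurve_of_mapsTo_cube hL (mapsTo_tetrisDrift hc.le K),
    fun α β hα hβ ↦ ?_⟩
  have hmem {γ : ℝ → Fin K → ℝ} (hγ : IsTetrisSolution c K γ) (t : ℝ)
      (ht : t ∈ Set.Ico (0 : ℝ) 1) : γ t ∈ Set.Icc (0 : Fin K → ℝ) 1 :=
    hγ.2.1 t (Set.Ico_subset_Icc_self ht)
  have hzero {γ : ℝ → Fin K → ℝ} (hγ : IsTetrisSolution c K γ) : γ 0 = 0 := by
    ext k
    simpa using hγ.2.2 0 (by simp) k
  exact ODE_solution_unique_of_mem_Icc_right (v := fun _ ↦ tetrisDrift c K) (fun _ _ ↦ hL)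
    hα.1 (fun _ ht ↦ hα.hasDerivWithinAt ht) (hmem hα)
    hβ.1 (fun _ ht ↦ hβ.hasDerivWithinAt ht) (hmem hβ) ((hzero hα).trans (hzero hβ).symm)
end

section
/- Fix c > 0 and an integer K ≥ 1. Define functions g_1, …, g_K : [0,1] → ℝ by g_1(t) = c^{−1} log(1 + ct) and g_i(t) = c^{−1} log( e^{c g_{i−1}(t)} − c g_{i−1}(t) ) for 2 ≤ i ≤ K (the argument of the logarithm is ≥ 1, so g_i is well defined and nonnegative). Then for every 1 ≤ k ≤ K and every t ∈ [0,1], g_k(t) = ∫_0^t e^{−c g_k(s)} ∏_{r=1}^{k−1} (1 − e^{−c g_r(s)}) ds, i.e., the g_k solve the SFAP limiting integral equation. -/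
open Finset

/-- The functions `g_i` solving the SFAP limiting integral equation:
`g 1 t = c⁻¹ log(1 + ct)` and
`g i t = c⁻¹ log(e^{c g (i−1) t} − c g (i−1) t)` for `i ≥ 2`
(and `g 0 = 0` by convention). -/
noncomputable def sfapG (c : ℝ) : ℕ → ℝ → ℝ
  | 0 => fun _ => 0
  | 1 => fun t => c⁻¹ * Real.log (1 + c * t)
  | (n + 2) => fun t =>
      c⁻¹ * Real.log (Real.exp (c * sfapG c (n + 1) t) - c * sfapG c (n + 1) t)

theorem one_le_exp_sub_self (x : ℝ) : 1 ≤ Real.exp x - x := by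
  linarith [Real.add_one_le_exp x]

theorem sfapG_nonneg {c : ℝ} (hc : 0 < c) {t : ℝ} (ht : 0 ≤ t) (n : ℕ) : 0 ≤ sfapG c n t := by
  match n with
  | 0 => simp [sfapG]
  | 1 =>
    have : 0 ≤ c * t := by positivity
    exact mul_nonneg (inv_nonneg.2 hc.le) (Real.log_nonneg (by linarith))
  | n + 2 => exact mul_nonneg (inv_nonneg.2 hc.le) (Real.log_nonneg (one_le_exp_sub_self _))

theorem sfapG_apply_zero (c : ℝ) (n : ℕ) : sfapG c n 0 = 0 := by
  induction n with
  | zero => simp [sfapG]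
  | succ n ih => cases n <;> simp_all [sfapG]

theorem hasDerivAt_sfapG {c : ℝ} (hc : 0 < c) {t : ℝ} (ht : 0 < 1 + c * t) (n : ℕ) :
    HasDerivAt (sfapG c (n + 1))
      (Real.exp (-c * sfapG c (n + 1) t) *
        ∏ r ∈ Finset.Icc 1 n, (1 - Real.exp (-c * sfapG c r t))) t := by
  induction n with
  | zero =>
    have h := ((((hasDerivAt_id t).const_mul c).const_add 1).log ht.ne').const_mul c⁻¹
    refine HasDerivAt.congr_deriv (f := sfapG c _) h ?_
    have e : -c * (c⁻¹ * Real.log (1 + c * t)) = -Real.log (1 + c * t) := by field_simp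
    simp only [sfapG, e, Real.exp_neg, Real.exp_log ht]
    simp [field]
  | succ n ih =>
    have hpos : 0 < Real.exp (c * sfapG c (n + 1) t) - c * sfapG c (n + 1) t :=
      one_pos.trans_le (one_le_exp_sub_self _)
    have hx := ih.const_mul c
    have h := ((hx.exp.sub hx).log hpos.ne').const_mul c⁻¹
    refine HasDerivAt.congr_deriv (f := sfapG c _) h ?_
    have e : Real.exp (-c * sfapG c (n + 1 + 1) t) =
        (Real.exp (c * sfapG c (n + 1) t) - c * sfapG c (n + 1) t)⁻¹ := by
      rw [sfapG, neg_mul, mul_inv_cancel_left₀ hc.ne', Real.exp_neg, Real.exp_log hpos]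
    rw [e, Finset.prod_Icc_succ_top (by omega), neg_mul, Real.exp_neg]
    simp only [Pi.sub_apply]
    field_simp

/-- For `c > 0` and `K ≥ 1`, the functions `g_1, …, g_K` defined by
`g_1(t) = c⁻¹ log(1 + ct)` and `g_i(t) = c⁻¹ log(e^{c g_{i−1}(t)} − c g_{i−1}(t))`
are well defined (the argument of the logarithm is `≥ 1`), nonnegative, and solve the
SFAP limiting integral equation
`g_k(t) = ∫_0^t e^{−c g_k(s)} ∏_{r=1}^{k−1} (1 − e^{−c g_r(s)}) ds`
for all `1 ≤ k ≤ K` and `t ∈ [0,1]`. -/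
theorem sfapG_solves_integral_equation (c : ℝ) (hc : 0 < c) (K : ℕ) (hK : 1 ≤ K) :
    ∀ k, 1 ≤ k → k ≤ K → ∀ t ∈ Set.Icc (0 : ℝ) 1,
      (2 ≤ k → 1 ≤ Real.exp (c * sfapG c (k - 1) t) - c * sfapG c (k - 1) t) ∧
      0 ≤ sfapG c k t ∧
      sfapG c k t
        = ∫ s in (0 : ℝ)..t,
            Real.exp (-c * sfapG c k s) *
              ∏ r ∈ Finset.Icc 1 (k - 1), (1 - Real.exp (-c * sfapG c r s)) := by
  rintro k hk - t ⟨ht, -⟩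
  obtain ⟨n, rfl⟩ := Nat.exists_eq_add_of_le' hk
  refine ⟨fun _ => one_le_exp_sub_self _, sfapG_nonneg hc ht _, ?_⟩
  have hpos : ∀ s ∈ Set.uIcc 0 t, 0 < 1 + c * s := fun s hs => by
    rw [Set.uIcc_of_le ht] at hs
    have := mul_nonneg hc.le hs.1
    linarith
  have hcont : ∀ r, 1 ≤ r → ContinuousOn (sfapG c r) (Set.uIcc 0 t) := fun r hr s hs => by
    obtain ⟨m, rfl⟩ := Nat.exists_eq_add_of_le' hr
    exact (hasDerivAt_sfapG hc (hpos s hs) m).continuousAt.continuousWithinAt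
  rw [Nat.add_sub_cancel, intervalIntegral.integral_eq_sub_of_hasDerivAt
    (fun s hs => hasDerivAt_sfapG hc (hpos s hs) n), sfapG_apply_zero, sub_zero]
  refine ContinuousOn.intervalIntegrable (ContinuousOn.mul ?_ ?_)
  · exact ((hcont _ hk).const_mul _).rexp
  · exact continuousOn_finsetProd _ fun r hr =>
      continuousOn_const.sub ((hcont r (Finset.mem_Icc.1 hr).1).const_mul _).rexp
end
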